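/- arXiv:math/9911257 — 3 statements merged into one kernel-verified Lean document; each statement's English description precedes it below -/
import Mathlib

section
/- For every real number λ ≤ 0, the map f_λ : ℝ² → ℝ⁴ defined by f_λ(x, y) = (x², y, x(λ − x² − y), xy) is injective. -/
/-- The local cusp model `f_λ(x, y) = (x², y, x(λ − x² − y), xy)`. -/
def cuspModel (l : ℝ) : ℝ × ℝ → ℝ × ℝ × ℝ × ℝ :=
  fun p => (p.1 ^ 2, p.2, p.1 * (l - p.1 ^ 2 - p.2), p.1 * p.2)

/-- For every `λ ≤ 0`, the local cusp model is injective. -/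
theorem cuspModel_injective_of_nonpos (l : ℝ) (hl : l ≤ 0) :
    Function.Injective (cuspModel l) := by
  rintro ⟨x, y⟩ ⟨x', y'⟩ h
  simp only [cuspModel, Prod.mk.injEq] at h ⊢
  obtain ⟨hsq, rfl, hcusp, hmul⟩ := h
  refine ⟨?_, rfl⟩
  have hprod : (x - x') * (l - x ^ 2) = 0 := by
    linear_combination hcusp + hmul + x' * hsq
  rcases mul_eq_zero.mp hprod with h | h
  · exact sub_eq_zero.mp h
  · have hx : x = 0 := by
      rw [← sq_eq_zero_iff]
      linarith [sq_nonneg x]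
    have hx' : x' = 0 := by
      rw [← sq_eq_zero_iff, ← hsq, hx]
      norm_num
    rw [hx, hx']
end

section
/- For every real number λ < 0, the map f_λ : ℝ² → ℝ⁴ defined by f_λ(x, y) = (x², y, x(λ − x² − y), xy) is a topological embedding (injective, continuous, and a homeomorphism onto its image with the subspace topology). -/
/-- A globally defined left inverse of the cusp model for `λ < 0`. The sum of the last two
coordinates of `f_λ(x, y)` is `x(λ − x²)`, from which `x` can be recovered. -/
noncomputable def cuspModelLeftInverse (l : ℝ) : ℝ × ℝ × ℝ × ℝ → ℝ × ℝ :=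
  fun q => ((q.2.2.1 + q.2.2.2) / (l - |q.1|), q.2.1)

theorem continuous_cuspModel (l : ℝ) : Continuous (cuspModel l) := by
  unfold cuspModel
  fun_prop

theorem continuous_cuspModelLeftInverse {l : ℝ} (hl : l < 0) :
    Continuous (cuspModelLeftInverse l) := by
  have h (q : ℝ × ℝ × ℝ × ℝ) : l - |q.1| ≠ 0 :=
    (by linarith [abs_nonneg q.1] : l - |q.1| < 0).ne
  unfold cuspModelLeftInverse
  fun_prop (disch := exact h)

theorem cuspModelLeftInverse_leftInverse {l : ℝ} (hl : l < 0) :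
    Function.LeftInverse (cuspModelLeftInverse l) (cuspModel l) := by
  rintro ⟨x, y⟩
  have h : l - x ^ 2 ≠ 0 := (by linarith [sq_nonneg x] : l - x ^ 2 < 0).ne
  simp only [cuspModel, cuspModelLeftInverse, abs_sq, Prod.mk.injEq, and_true]
  rw [div_eq_iff h]
  ring

/-- For every `λ < 0`, the local cusp model is a topological embedding. -/
theorem cuspModel_isEmbedding_of_neg (l : ℝ) (hl : l < 0) :
    Topology.IsEmbedding (cuspModel l) := by
  exact (cuspModelLeftInverse_leftInverse hl).isEmbedding
    (continuous_cuspModelLeftInverse hl) (continuous_cuspModel l)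
end

section
/- Let λ > 0 be a real number and let f_λ : ℝ² → ℝ⁴ be defined by f_λ(x, y) = (x², y, x(λ − x² − y), xy). Then f_λ(√λ, 0) = f_λ(−√λ, 0), and for any two distinct points p, q ∈ ℝ² with f_λ(p) = f_λ(q), the pair {p, q} equals {(√λ, 0), (−√λ, 0)}. In particular, after the cusp birth the map has exactly one self-intersection point. -/
/-- For `λ > 0`, the local cusp model has exactly one self-intersection point:
`f_λ(√λ, 0) = f_λ(−√λ, 0)`, and any two distinct points with the same image
form the pair `{(√λ, 0), (−√λ, 0)}`. -/
theorem cuspModel_double_point (l : ℝ) (hl : 0 < l) :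
    cuspModel l (Real.sqrt l, 0) = cuspModel l (-Real.sqrt l, 0) ∧
      ∀ p q : ℝ × ℝ, p ≠ q → cuspModel l p = cuspModel l q →
        ({p, q} : Set (ℝ × ℝ)) = {(Real.sqrt l, 0), (-Real.sqrt l, 0)} := by
  refine ⟨by simp [cuspModel, Real.sq_sqrt hl.le], ?_⟩
  rintro ⟨a, b⟩ ⟨c, d⟩ hne h
  simp only [cuspModel, Prod.mk.injEq] at h
  obtain ⟨hsq, rfl, hcubic, hprod⟩ := h
  have hac : a ≠ c := fun hac => hne (by rw [hac])
  obtain rfl : c = -a := by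
    rcases sq_eq_sq_iff_eq_or_eq_neg.mp hsq with h | h
    · exact absurd h hac
    · linarith
  have ha : a ≠ 0 := by
    rintro rfl
    simp at hac
  obtain rfl : b = 0 := mul_left_cancel₀ ha (by linarith)
  have hal : a ^ 2 = Real.sqrt l ^ 2 := by
    rw [Real.sq_sqrt hl.le]
    exact mul_left_cancel₀ ha (by linarith)
  rcases sq_eq_sq_iff_eq_or_eq_neg.mp hal with rfl | rfl
  · rfl
  · rw [neg_neg, Set.pair_comm]
end
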